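/- There exists N such that for every integer n ≥ N with n not congruent to 4 (mod 7), the number of isomorphism classes of cyclic (K_{10n+1}, C_5)-designs satisfies NC(10n+1, 5) ≥ 29.7^n. -/

import Mathlib

namespace CCS

/-- A block: a set of edges of the complete graph on `ZMod v`. -/
abbrev Block (v : ℕ) := Finset (Sym2 (ZMod v))

/-- The edge set of the closed tuple `c = (c 0, c 1, …, c (k-1))`. -/
def edgesOf {v k : ℕ} (c : Fin k → ZMod v) : Block v :=
  Finset.image (fun i : Fin k => s(c i, c ⟨(i.1 + 1) % k, Nat.mod_lt _ i.pos⟩)) Finset.univ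

/-- `E` is the edge set of a `k`-cycle on `ZMod v`. Since for `k ≥ 3` the edge set
determines the closed tuple up to rotation and reversal, a `k`-cycle is identified
with its edge set. -/
def IsCycleBlock (v k : ℕ) (E : Block v) : Prop :=
  ∃ c : Fin k → ZMod v, Function.Injective c ∧ E = edgesOf c

/-- The translate `E + z` of a cycle. -/
def translateBlock {v : ℕ} (E : Block v) (z : ZMod v) : Block v :=
  E.image (Sym2.map (· + z))

/-- A `(K_v, C_k)`-design: a set of `k`-cycles whose edge sets partition the edges of `K_v`. -/
def IsDesign (v k : ℕ) (B : Set (Block v)) : Prop :=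
  (∀ E ∈ B, IsCycleBlock v k E) ∧
  ∀ e : Sym2 (ZMod v), ¬ e.IsDiag → ∃! E, E ∈ B ∧ e ∈ E

/-- A cyclic `(K_v, C_k)`-design. -/
def IsCyclicDesign (v k : ℕ) (B : Set (Block v)) : Prop :=
  IsDesign v k B ∧ ∀ E ∈ B, ∀ z : ZMod v, translateBlock E z ∈ B

/-- Two designs are isomorphic if a bijection of `ZMod v` maps one onto the other. -/
def Isomorphic {v : ℕ} (B B' : Set (Block v)) : Prop :=
  ∃ f : ZMod v ≃ ZMod v, B' = (fun E : Block v => E.image (Sym2.map f)) '' B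

/-- `NC v k`: the number of cyclic `(K_v, C_k)`-designs up to isomorphism. -/
noncomputable def NC (v k : ℕ) : ℕ :=
  Nat.card (Quot fun B B' : {B : Set (Block v) // IsCyclicDesign v k B} =>
    Isomorphic B.1 B'.1)

/-- The type of a cycle: the order of its stabilizer under translations. -/
noncomputable def cycleType {v : ℕ} (E : Block v) : ℕ :=
  Nat.card {z : ZMod v // translateBlock E z = E}

/-- The two differences `±(a-b)` arising from an edge `{a,b}`. -/
def edgeDiffs {v : ℕ} : Sym2 (ZMod v) → Multiset (ZMod v) :=
  Sym2.lift ⟨fun a b => {a - b, b - a}, fun a b => by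
    show (a-b) ::ₘ {b-a} = (b-a) ::ₘ {a-b}; exact Multiset.cons_swap _ _ _⟩

/-- The multiset of the `2k` differences arising from the `k` edges of a cycle.
For a cycle of type `d` this is `d` copies of the list `∂C` of partial differences. -/
def fullDiffs {v : ℕ} (E : Block v) : Multiset (ZMod v) :=
  E.val.bind edgeDiffs

/-- The multiset `∂C` of partial differences of a cycle: each difference is counted
with multiplicity equal to its multiplicity among the `2k` edge differences divided
by the type of the cycle. -/
noncomputable def partialDiffs {v : ℕ} (E : Block v) : Multiset (ZMod v) :=
  (fullDiffs E).toFinset.val.bind fun x =>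
    Multiset.replicate ((fullDiffs E).count x / cycleType E) x

/-- A `(K_v, C_k)`-difference system: a set of `k`-cycles whose partial differences
cover every nonzero element of `ZMod v` exactly once. -/
def IsDifferenceSystem (v k : ℕ) (F : Finset (Block v)) : Prop :=
  (∀ E ∈ F, IsCycleBlock v k E) ∧
  ∀ x : ZMod v, (F.val.bind partialDiffs).count x = if x = 0 then 0 else 1

end CCS

namespace CCS

section Base

variable {v : ℕ}

lemma mem_edgesOf {c : Fin 5 → ZMod v} {e : Sym2 (ZMod v)} :
    e ∈ edgesOf c ↔ ∃ i : Fin 5, s(c i, c (i + 1)) = e := by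
  have h : ∀ i : Fin 5, (⟨(i.1 + 1) % 5, Nat.mod_lt _ i.pos⟩ : Fin 5) = i + 1 := by decide
  simp [edgesOf, h]

lemma translateBlock_edgesOf (c : Fin 5 → ZMod v) (z : ZMod v) :
    translateBlock (edgesOf c) z = edgesOf (fun j => c j + z) := by
  simp only [translateBlock, edgesOf, Finset.image_image]
  rfl

/-- The vertices of the closed walk from `0` with successive steps `h 0, …, h 4`. -/
def partialSums (h : Fin 5 → ZMod v) : Fin 5 → ZMod v :=
  ![0, h 0, h 0 + h 1, h 0 + h 1 + h 2, h 0 + h 1 + h 2 + h 3]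

lemma partialSums_succ {h : Fin 5 → ZMod v} (hs : ∑ j, h j = 0) (j : Fin 5) :
    partialSums h (j + 1) = partialSums h j + h j := by
  simp only [Fin.sum_univ_five] at hs
  fin_cases j <;> simp [partialSums, hs]

lemma partialSums_injective {h : Fin 5 → ZMod v} (hs : ∑ j, h j = 0) (h0 : ∀ j, h j ≠ 0)
    (h1 : ∀ j k, j ≠ k → h j + h k ≠ 0) : Function.Injective (partialSums h) := by
  simp only [Fin.sum_univ_five] at hs
  have a01 := h1 0 1 (by decide)
  have a12 := h1 1 2 (by decide)
  have a23 := h1 2 3 (by decide)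
  have a34 := h1 3 4 (by decide)
  have a40 := h1 4 0 (by decide)
  have b0 := h0 0
  have b1 := h0 1
  have b2 := h0 2
  have b3 := h0 3
  have b4 := h0 4
  intro i j hij
  fin_cases i <;> fin_cases j <;> simp [partialSums] at hij ⊢ <;> grind

/-- A family of zero-sum quintuples whose entries, taken with both signs, run exactly once
through the nonzero elements of `ZMod v`. -/
structure IsBaseFamily {ι : Type*} (g : ι → Fin 5 → ZMod v) : Prop where
  sum_eq : ∀ i, ∑ j, g i j = 0
  ne_zero : ∀ i j, g i j ≠ 0
  surj : ∀ x, x ≠ 0 → ∃ i j, x = g i j ∨ x = -g i j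
  inj : ∀ i j i' j', g i j = g i' j' → i = i' ∧ j = j'
  ne_neg : ∀ i j i' j', g i j ≠ -g i' j'

lemma IsBaseFamily.of_card {n : ℕ} {ι : Type*} [Fintype ι]
    (hι : Fintype.card ι = n) (g : ι → Fin 5 → ZMod (10 * n + 1))
    (sum_eq : ∀ i, ∑ j, g i j = 0)
    (surj : ∀ x, x ≠ 0 → ∃ i j, x = g i j ∨ x = -g i j) : IsBaseFamily g := by
  classical
  let φ : ι × Fin 5 × Bool → ZMod (10 * n + 1) :=
    fun p => if p.2.2 then g p.1 p.2.1 else -g p.1 p.2.1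
  have hsub : (Finset.univ.erase (0 : ZMod (10 * n + 1))) ⊆ Finset.univ.image φ := by
    intro x hx
    obtain ⟨i, j, h | h⟩ := surj x (by simpa using hx)
    · exact Finset.mem_image.2 ⟨(i, j, true), by simp, by simp [φ, h]⟩
    · exact Finset.mem_image.2 ⟨(i, j, false), by simp, by simp [φ, h]⟩
  have hcard : (Finset.univ : Finset (ι × Fin 5 × Bool)).card = 10 * n := by
    simp [hι]; ring
  have hcard' : (Finset.univ.erase (0 : ZMod (10 * n + 1))).card = 10 * n := by
    simp [Finset.card_erase_of_mem, ZMod.card]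
  have him := Finset.card_image_le (s := Finset.univ) (f := φ)
  have heq := Finset.eq_of_subset_of_card_le hsub (by omega)
  have hinj : Function.Injective φ := by
    have : (Finset.univ.image φ).card = (Finset.univ : Finset (ι × Fin 5 × Bool)).card := by
      rw [← heq]; omega
    have := Finset.card_image_iff.1 this
    simpa using this
  have hne : ∀ i j, g i j ≠ 0 := by
    intro i j
    have : φ (i, j, true) ∈ Finset.univ.image φ := Finset.mem_image_of_mem _ (by simp)
    rw [← heq] at this
    simpa [φ] using this
  refine ⟨sum_eq, hne, surj, ?_, ?_⟩
  · intro i j i' j' h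
    have := @hinj (i, j, true) (i', j', true) (by simpa [φ] using h)
    simpa using this
  · intro i j i' j' h
    have := @hinj (i, j, true) (i', j', false) (by simpa [φ] using h)
    simp at this

/-- All translates of the cycles developed from a family of step quintuples. -/
def development {ι : Type*} (g : ι → Fin 5 → ZMod v) : Set (Block v) :=
  {E | ∃ i z, E = edgesOf (fun j => partialSums (g i) j + z)}

lemma mem_edgesOf_partialSums {h : Fin 5 → ZMod v} (hs : ∑ j, h j = 0) {a b z : ZMod v} :
    s(a, b) ∈ edgesOf (fun j => partialSums h j + z) ↔
      ∃ j, (b - a = h j ∧ z = a - partialSums h j) ∨ (a - b = h j ∧ z = b - partialSums h j) := by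
  rw [mem_edgesOf]
  refine exists_congr fun j => ?_
  rw [partialSums_succ hs, Sym2.eq_iff]
  grind

lemma IsBaseFamily.isCyclicDesign {ι : Type*} {g : ι → Fin 5 → ZMod v} (hg : IsBaseFamily g) :
    IsCyclicDesign v 5 (development g) := by
  refine ⟨⟨?_, ?_⟩, ?_⟩
  · rintro E ⟨i, z, rfl⟩
    refine ⟨_, ?_, rfl⟩
    have := partialSums_injective (hg.sum_eq i) (hg.ne_zero i) (fun j k _ h =>
      hg.ne_neg i j i k (eq_neg_of_add_eq_zero_left h))
    exact fun a b hab => this (by simpa using hab)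
  · intro e
    induction e using Sym2.ind with
    | _ a b =>
    intro hab
    have hab : b - a ≠ 0 := by
      rw [sub_ne_zero]; rintro rfl; exact hab rfl
    have hex : ∃ i z, s(a, b) ∈ edgesOf (fun j => partialSums (g i) j + z) := by
      obtain ⟨i, j, h | h⟩ := hg.surj _ hab
      · exact ⟨i, _, (mem_edgesOf_partialSums (hg.sum_eq i)).2 ⟨j, Or.inl ⟨h, rfl⟩⟩⟩
      · exact ⟨i, _, (mem_edgesOf_partialSums (hg.sum_eq i)).2
          ⟨j, Or.inr ⟨by rw [← neg_sub, h, neg_neg], rfl⟩⟩⟩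
    obtain ⟨i, z, hiz⟩ := hex
    refine ⟨_, ⟨⟨i, z, rfl⟩, hiz⟩, ?_⟩
    rintro _ ⟨⟨i', z', rfl⟩, hiz'⟩
    rw [mem_edgesOf_partialSums (hg.sum_eq _)] at hiz hiz'
    obtain ⟨j, hj⟩ := hiz
    obtain ⟨j', hj'⟩ := hiz'
    suffices i' = i ∧ z' = z by rw [this.1, this.2]
    have h1 := hg.inj i j i' j'
    have h2 := hg.ne_neg i j i' j'
    grind
  · rintro E ⟨i, z, rfl⟩ w
    rw [translateBlock_edgesOf]
    exact ⟨i, z + w, by simp only [add_assoc]⟩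

end Base

/-- The quintuples obtained by completing the `i`-th triple with the `π i`-th pair, together
with some fixed quintuples. -/
def spliced {v K c : ℕ} (t₀ t₁ t₂ p₀ p₁ : Fin K → ZMod v) (S : Fin c → Fin 5 → ZMod v)
    (π : Equiv.Perm (Fin K)) : Fin K ⊕ Fin c → Fin 5 → ZMod v :=
  Sum.elim (fun i => ![t₀ i, t₁ i, t₂ i, p₀ (π i), p₁ (π i)]) S

theorem exists_injective_perm {n K c : ℕ} (hn : K + c = n)
    (t₀ t₁ t₂ p₀ p₁ : Fin K → ZMod (10 * n + 1)) (S : Fin c → Fin 5 → ZMod (10 * n + 1))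
    (D : ZMod (10 * n + 1)) (ht : ∀ i, t₀ i + t₁ i + t₂ i = -D) (hp : ∀ i, p₀ i + p₁ i = D)
    (hS : ∀ i, ∑ j, S i j = 0)
    (surj : ∀ x, x ≠ 0 → (∃ i, x = t₀ i ∨ x = -t₀ i) ∨ (∃ i, x = t₁ i ∨ x = -t₁ i) ∨
      (∃ i, x = t₂ i ∨ x = -t₂ i) ∨ (∃ i, x = p₀ i ∨ x = -p₀ i) ∨ (∃ i, x = p₁ i ∨ x = -p₁ i) ∨
      ∃ i j, x = S i j ∨ x = -S i j) :
    ∃ F : Equiv.Perm (Fin K) → {B : Set (Block (10 * n + 1)) // IsCyclicDesign (10 * n + 1) 5 B},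
      Function.Injective F := by
  have hbase : ∀ π, IsBaseFamily (spliced t₀ t₁ t₂ p₀ p₁ S π) := by
    intro π
    refine IsBaseFamily.of_card (by simp [hn]) _ ?_ ?_
    · rintro (i | i)
      · simp only [spliced, Sum.elim_inl, Fin.sum_univ_five]
        have h1 := ht i
        have h2 := hp (π i)
        simp
        linear_combination h1 + h2
      · exact hS i
    · intro x hx
      rcases surj x hx with ⟨i, h⟩ | ⟨i, h⟩ | ⟨i, h⟩ | ⟨i, h⟩ | ⟨i, h⟩ | ⟨i, j, h⟩
      · exact ⟨Sum.inl i, 0, h⟩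
      · exact ⟨Sum.inl i, 1, h⟩
      · exact ⟨Sum.inl i, 2, h⟩
      · exact ⟨Sum.inl (π.symm i), 3, by simpa [spliced] using h⟩
      · exact ⟨Sum.inl (π.symm i), 4, by simpa [spliced] using h⟩
      · exact ⟨Sum.inr i, j, h⟩
  refine ⟨fun π => ⟨_, (hbase π).isCyclicDesign⟩, ?_⟩
  intro π π' h
  have h : development (spliced t₀ t₁ t₂ p₀ p₁ S π) = development (spliced t₀ t₁ t₂ p₀ p₁ S π') :=
    congrArg Subtype.val h
  ext i : 1
  set g := spliced t₀ t₁ t₂ p₀ p₁ S π with hg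
  set g' := spliced t₀ t₁ t₂ p₀ p₁ S π' with hg'
  have hg0 : g (Sum.inl i) 0 = g' (Sum.inl i) 0 := rfl
  have hE : edgesOf (fun j => partialSums (g (Sum.inl i)) j + 0) =
      edgesOf (fun j => partialSums (g' (Sum.inl i)) j + 0) := by
    have hd := (hbase π).isCyclicDesign.1.2 s(0, g (Sum.inl i) 0)
      (by simpa using ((hbase π).ne_zero (Sum.inl i) 0).symm)
    refine hd.unique ⟨⟨_, _, rfl⟩, ?_⟩ ⟨?_, ?_⟩
    · rw [mem_edgesOf_partialSums ((hbase π).sum_eq _)]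
      exact ⟨0, Or.inl ⟨by simp [g], by simp [partialSums]⟩⟩
    · rw [← hg, h]
      exact ⟨_, _, rfl⟩
    · rw [mem_edgesOf_partialSums ((hbase π').sum_eq _)]
      exact ⟨0, Or.inl ⟨by simp [hg0, g'], by simp [partialSums]⟩⟩
  have hmem : s(partialSums (g (Sum.inl i)) 3 + 0, partialSums (g (Sum.inl i)) 4 + 0) ∈
      edgesOf (fun j => partialSums (g' (Sum.inl i)) j + 0) := by
    rw [← hE]
    exact mem_edgesOf.2 ⟨3, rfl⟩
  rw [mem_edgesOf_partialSums ((hbase π').sum_eq _)] at hmem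
  have h3 : partialSums (g (Sum.inl i)) 4 - partialSums (g (Sum.inl i)) 3 =
      g' (Sum.inl (π'.symm (π i))) 3 := by
    simp [partialSums, g, g', spliced]
  obtain ⟨j, ⟨h4, -⟩ | ⟨h4, -⟩⟩ := hmem
  · have := ((hbase π').inj (Sum.inl (π'.symm (π i))) 3 (Sum.inl i) j
      (h3.symm.trans (by rw [← hg'] at h4; rw [← hg', ← h4]; ring))).1
    rw [Sum.inl.injEq, Equiv.symm_apply_eq] at this
    rw [this]
  · exact absurd (h3.symm.trans (by rw [← hg'] at h4; rw [← hg', ← h4]; ring))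
      ((hbase π').ne_neg (Sum.inl (π'.symm (π i))) 3 (Sum.inl i) j)

/-- The smaller member of the pair with difference `x + μ` in a partition of
`{2 * μ + 2, …, 6 * μ + 3}` into pairs with differences `μ + 1, …, 3 * μ + 1`. -/
def langfordLeft (μ x : ℕ) : ℕ :=
  if x % 2 = 1 then 3 * μ + 2 - (x - 1) / 2 else 4 * μ + 2 - (x - 2) / 2

/-- The increasing enumeration of the positive integers other than `x₀`. -/
def skipping (x₀ i : ℕ) : ℕ := if i + 1 < x₀ then i + 1 else i + 2

/-- The smaller members of the pairs with difference `μ` in the two intervals of length `2 * μ`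
that start at `β₁` and `β₂`. -/
def parallelLeft (μ β₁ β₂ i : ℕ) : ℕ := if i < μ then β₁ + i else β₂ + (i - μ)

lemma exists_skipping {μ x₀ x : ℕ} (hx : 1 ≤ x) (hx' : x ≤ 2 * μ + 1) (h : x ≠ x₀)
    (h1 : 1 ≤ x₀) (h0 : x₀ ≤ 2 * μ + 1) : ∃ i : Fin (2 * μ), skipping x₀ i = x := by
  by_cases hlt : x < x₀
  · exact ⟨⟨x - 1, by omega⟩, by simp only [skipping]; split_ifs <;> omega⟩
  · exact ⟨⟨x - 2, by omega⟩, by simp only [skipping]; split_ifs <;> omega⟩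

lemma exists_langford {μ t : ℕ} (ht : 1 ≤ t) (ht' : t ≤ 6 * μ + 3) :
    ∃ x, 1 ≤ x ∧ x ≤ 2 * μ + 1 ∧
      (t = x ∨ t = langfordLeft μ x ∨ t = langfordLeft μ x + x + μ) := by
  by_cases h1 : t ≤ 2 * μ + 1
  · exact ⟨t, by omega, by omega, by omega⟩
  by_cases h2 : t ≤ 3 * μ + 2
  · refine ⟨2 * (3 * μ + 2 - t) + 1, by omega, by omega, ?_⟩
    simp only [langfordLeft]; split_ifs <;> omega
  by_cases h3 : t ≤ 4 * μ + 2
  · refine ⟨2 * (4 * μ + 2 - t) + 2, by omega, by omega, ?_⟩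
    simp only [langfordLeft]; split_ifs <;> omega
  by_cases h4 : t ≤ 5 * μ + 3
  · refine ⟨2 * (t - (4 * μ + 3)) + 1, by omega, by omega, ?_⟩
    simp only [langfordLeft]; split_ifs <;> omega
  · refine ⟨2 * (t - (5 * μ + 4)) + 2, by omega, by omega, ?_⟩
    simp only [langfordLeft]; split_ifs <;> omega

lemma exists_parallel {μ β₁ β₂ t : ℕ}
    (h : (β₁ ≤ t ∧ t < β₁ + 2 * μ) ∨ (β₂ ≤ t ∧ t < β₂ + 2 * μ)) :
    ∃ i : Fin (2 * μ), t = parallelLeft μ β₁ β₂ i ∨ t = parallelLeft μ β₁ β₂ i + μ := by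
  rcases h with h | h
  · by_cases hlt : t < β₁ + μ
    · exact ⟨⟨t - β₁, by omega⟩, by simp only [parallelLeft]; split_ifs <;> omega⟩
    · exact ⟨⟨t - β₁ - μ, by omega⟩, by simp only [parallelLeft]; split_ifs <;> omega⟩
  · by_cases hlt : t < β₂ + μ
    · exact ⟨⟨t - β₂ + μ, by omega⟩, by simp only [parallelLeft]; split_ifs <;> omega⟩
    · exact ⟨⟨t - β₂, by omega⟩, by simp only [parallelLeft]; split_ifs <;> omega⟩

lemma exists_natCast_eq_or_eq_neg {n : ℕ} (x : ZMod (10 * n + 1)) (hx : x ≠ 0) :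
    ∃ t : ℕ, 1 ≤ t ∧ t ≤ 5 * n ∧ (x = t ∨ x = -t) := by
  have hv : x.val < 10 * n + 1 := ZMod.val_lt x
  have h0 : x.val ≠ 0 := by simpa using hx
  have hc : (x.val : ZMod (10 * n + 1)) = x := ZMod.natCast_zmod_val x
  by_cases h : x.val ≤ 5 * n
  · exact ⟨x.val, by omega, h, Or.inl hc.symm⟩
  · refine ⟨10 * n + 1 - x.val, by omega, by omega, Or.inr ?_⟩
    rw [Nat.cast_sub hv.le, hc, ZMod.natCast_self]
    ring

theorem exists_injective_perm_of_langford {n c μ x₀ β₁ β₂ : ℕ} (hn : 2 * μ + c = n)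
    (hx₀ : 1 ≤ x₀) (hx₀' : x₀ ≤ 2 * μ + 1) (S : Fin c → Fin 5 → ℤ)
    (hS : ∀ i, ((10 * n + 1 : ℕ) : ℤ) ∣ ∑ j, S i j)
    (hcov : ∀ t, 1 ≤ t → t ≤ 5 * n →
      (t ≤ 6 * μ + 3 ∧ t ≠ x₀ ∧ t ≠ langfordLeft μ x₀ ∧ t ≠ langfordLeft μ x₀ + x₀ + μ) ∨
      ((β₁ ≤ t ∧ t < β₁ + 2 * μ) ∨ (β₂ ≤ t ∧ t < β₂ + 2 * μ)) ∨
      ∃ i j, (t : ℤ) = S i j ∨ (t : ℤ) = -S i j) :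
    ∃ F : Equiv.Perm (Fin (2 * μ)) →
        {B : Set (Block (10 * n + 1)) // IsCyclicDesign (10 * n + 1) 5 B},
      Function.Injective F := by
  refine exists_injective_perm hn
    (fun i => (skipping x₀ i : ℕ)) (fun i => (langfordLeft μ (skipping x₀ i) : ℕ))
    (fun i => -(langfordLeft μ (skipping x₀ i) + skipping x₀ i + μ : ℕ))
    (fun i => (parallelLeft μ β₁ β₂ i + μ : ℕ)) (fun i => -(parallelLeft μ β₁ β₂ i : ℕ))
    (fun i j => (S i j : ZMod (10 * n + 1))) μ ?_ ?_ ?_ ?_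
  · intro i; push_cast; ring
  · intro i; push_cast; ring
  · intro i
    rw [← Int.cast_sum, ZMod.intCast_zmod_eq_zero_iff_dvd]
    exact hS i
  · intro x hx
    obtain ⟨t, h1, h2, ht⟩ := exists_natCast_eq_or_eq_neg x hx
    rcases hcov t h1 h2 with ⟨h3, h4⟩ | h | ⟨i, j, h⟩
    · obtain ⟨y, hy1, hy2, hy⟩ := exists_langford h1 h3
      have hne : y ≠ x₀ := by rintro rfl; omega
      obtain ⟨i, rfl⟩ := exists_skipping hy1 hy2 hne hx₀ hx₀'
      rcases hy with hy | hy | hy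
      · exact Or.inl ⟨i, by rwa [← hy]⟩
      · exact Or.inr (Or.inl ⟨i, by rwa [← hy]⟩)
      · exact Or.inr (Or.inr (Or.inl ⟨i, by rw [← hy, neg_neg]; exact ht.symm⟩))
    · obtain ⟨i, h | h⟩ := exists_parallel h
      · exact Or.inr (Or.inr (Or.inr (Or.inr (Or.inl
          ⟨i, by rw [← h, neg_neg]; exact ht.symm⟩))))
      · exact Or.inr (Or.inr (Or.inr (Or.inl ⟨i, by rwa [← h]⟩)))
    · refine Or.inr (Or.inr (Or.inr (Or.inr (Or.inr ⟨i, j, ?_⟩))))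
      have h' : (t : ZMod (10 * n + 1)) = S i j ∨ (t : ZMod (10 * n + 1)) = -S i j := by
        rcases h with h | h
        · left; exact_mod_cast congrArg (Int.cast : ℤ → ZMod (10 * n + 1)) h
        · right; exact_mod_cast congrArg (Int.cast : ℤ → ZMod (10 * n + 1)) h
      rcases h' with h' | h' <;> rcases ht with rfl | rfl <;> simp [h']

/-- For large `n` there are at least `(n - 2)!` cyclic designs. -/
theorem exists_injective_perm_of_large {n : ℕ} (hn : 20 ≤ n) :
    ∃ K, n ≤ K + 2 ∧ ∃ F : Equiv.Perm (Fin K) →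
        {B : Set (Block (10 * n + 1)) // IsCyclicDesign (10 * n + 1) 5 B},
      Function.Injective F := by
  obtain ⟨r, hr | hr | hr | hr⟩ : ∃ r, n = 2 * (2 * r) + 1 ∨ n = 2 * (2 * r + 1) + 1 ∨
      n = 2 * (2 * r) + 2 ∨ n = 2 * (2 * r + 1) + 2 := ⟨(n - 1) / 4, by omega⟩
  · refine ⟨2 * (2 * r), by omega, exists_injective_perm_of_langford (c := 1) (x₀ := r + 1)
      (β₁ := 12 * r + 4) (β₂ := 16 * r + 5) (by omega) (by omega) (by omega)
      (fun _ => ![r + 1, -langfordLeft (2 * r) (r + 1),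
        langfordLeft (2 * r) (r + 1) + (r + 1) + 2 * r, 16 * r + 4, 20 * r + 5]) ?_ ?_⟩
    · intro i
      refine ⟨1, ?_⟩
      simp [Fin.sum_univ_five]
      omega
    · intro t h1 h2
      simp [Fin.exists_fin_succ]
      omega
  · refine ⟨2 * (2 * r + 1), by omega, exists_injective_perm_of_langford (c := 1) (x₀ := r + 1)
      (β₁ := 12 * r + 11) (β₂ := 16 * r + 14) (by omega) (by omega) (by omega)
      (fun _ => ![r + 1, -langfordLeft (2 * r + 1) (r + 1),
        langfordLeft (2 * r + 1) (r + 1) + (r + 1) + (2 * r + 1), 12 * r + 10,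
        -(16 * r + 13)]) ?_ ?_⟩
    · intro i
      refine ⟨0, ?_⟩
      simp [Fin.sum_univ_five]
      omega
    · intro t h1 h2
      simp [Fin.exists_fin_succ]
      omega
  · have hL : langfordLeft (2 * r) (2 * r + 5) = 5 * r := by
      simp only [langfordLeft]; split_ifs <;> omega
    refine ⟨2 * (2 * r), by omega, exists_injective_perm_of_langford (c := 2) (x₀ := 2 * r + 5)
      (β₁ := 12 * r + 9) (β₂ := 16 * r + 10) (by omega) (by omega) (by omega)
      ![![12 * r + 4, 12 * r + 7, 12 * r + 8, -(16 * r + 9), -(20 * r + 10)],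
        ![12 * r + 5, 12 * r + 6, 2 * r + 5, 5 * r, 9 * r + 5]] ?_ ?_⟩
    · intro i
      fin_cases i
      · refine ⟨0, ?_⟩
        simp [Fin.sum_univ_five]
        omega
      · refine ⟨1, ?_⟩
        simp [Fin.sum_univ_five]
        omega
    · intro t h1 h2
      rw [hL]
      simp [Fin.exists_fin_succ]
      omega
  · have hL : langfordLeft (2 * r + 1) (2 * r + 1) = 5 * r + 5 := by
      simp only [langfordLeft]; split_ifs <;> omega
    refine ⟨2 * (2 * r + 1), by omega, exists_injective_perm_of_langford (c := 2)
      (x₀ := 2 * r + 1) (β₁ := 12 * r + 16) (β₂ := 16 * r + 19) (by omega) (by omega) (by omega)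
      ![![12 * r + 10, 12 * r + 11, -(12 * r + 12), 12 * r + 14, 16 * r + 18],
        ![12 * r + 13, 12 * r + 15, 2 * r + 1, 5 * r + 5, 9 * r + 7]] ?_ ?_⟩
    · intro i
      fin_cases i
      · refine ⟨1, ?_⟩
        simp [Fin.sum_univ_five]
        omega
      · refine ⟨1, ?_⟩
        simp [Fin.sum_univ_five]
        omega
    · intro t h1 h2
      rw [hL]
      simp [Fin.exists_fin_succ]
      omega

section Step

variable {V : Type*}

/-- `N` continues every path `x, w` along a `5`-cycle, and does so consistently. -/
def IsStep (N : V → V → V) : Prop :=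
  ∀ x w, x ≠ w → ∃ c : Fin 5 → V, Function.Injective c ∧ c 0 = x ∧ c 1 = w ∧
    ∀ i, N (c i) (c (i + 1)) = c (i + 2) ∧ N (c (i + 2)) (c (i + 1)) = c i

/-- `W` is the vertex set of a subsystem. -/
def IsSubsystem (N : V → V → V) (W : Finset V) : Prop :=
  ∀ x ∈ W, ∀ w ∈ W, x ≠ w → N x w ∈ W

lemma card_le_sq_card_sdiff [DecidableEq V] {N : V → V → V} (hN : IsStep N) {W W' : Finset V}
    (hW : IsSubsystem N W) (hW' : IsSubsystem N W') (hsub : W ⊆ W') {x : V} (hx : x ∈ W')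
    (hxW : x ∉ W) : W.card ≤ (W' \ W).card ^ 2 := by
  have hsubset : W ⊆ Finset.image (fun p : V × V => N p.1 p.2) ((W' \ W) ×ˢ (W' \ W)) := by
    intro w hw
    obtain ⟨c, hc, rfl, rfl, h⟩ := hN x w (by rintro rfl; exact hxW hw)
    have h2 : c 2 ∈ W' := (h 0).1 ▸ hW' _ hx _ (hsub hw) (hc.ne (by decide))
    have h3 : c 3 ∈ W' := (h 1).1 ▸ hW' _ (hsub hw) _ h2 (hc.ne (by decide))
    have h4 : c 4 ∈ W' := (h 2).1 ▸ hW' _ h2 _ h3 (hc.ne (by decide))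
    have n2 : c 2 ∉ W := fun h' => hxW ((h 0).2 ▸ hW _ h' _ hw (hc.ne (by decide)))
    by_cases m3 : c 3 ∈ W
    · have n4 : c 4 ∉ W := fun h' => n2 ((h 2).2 ▸ hW _ h' _ m3 (hc.ne (by decide)))
      exact Finset.mem_image.2 ⟨(c 4, c 0), by simp [h4, n4, hx, hxW], (h 4).1⟩
    · exact Finset.mem_image.2 ⟨(c 3, c 2), by simp [h3, m3, h2, n2], (h 1).2⟩
  calc W.card ≤ _ := Finset.card_le_card hsubset
    _ ≤ _ := Finset.card_image_le
    _ = _ := by rw [Finset.card_product, sq]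

open Classical in
/-- The subsystem generated by `G`. -/
noncomputable def generated [Fintype V] (N : V → V → V) (G : Finset V) : Finset V :=
  Finset.univ.filter fun x => ∀ W, IsSubsystem N W → G ⊆ W → x ∈ W

lemma isSubsystem_generated [Fintype V] (N : V → V → V) (G : Finset V) :
    IsSubsystem N (generated N G) := by
  intro x hx w hw hne
  simp only [generated, Finset.mem_filter, Finset.mem_univ, true_and] at hx hw ⊢
  exact fun W hW hG => hW _ (hx W hW hG) _ (hw W hW hG) hne

lemma subset_generated [Fintype V] (N : V → V → V) (G : Finset V) : G ⊆ generated N G := by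
  intro x hx
  simp only [generated, Finset.mem_filter, Finset.mem_univ, true_and]
  exact fun W _ hG => hG hx

lemma generated_subset [Fintype V] {N : V → V → V} {G W : Finset V} (hW : IsSubsystem N W)
    (hG : G ⊆ W) : generated N G ⊆ W := by
  intro x hx
  simp only [generated, Finset.mem_filter, Finset.mem_univ, true_and] at hx
  exact hx W hW hG

lemma exists_card_le_generated [Fintype V] {N : V → V → V} (hN : IsStep N) (M m : ℕ) :
    ∃ G : Finset V, G.card ≤ M ^ 2 + m ∧
      (generated N G = Finset.univ ∨ M ^ 2 + M * m ≤ (generated N G).card) := by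
  classical
  induction m with
  | zero =>
    by_cases h : M ^ 2 ≤ (Finset.univ : Finset V).card
    · obtain ⟨G, -, hG⟩ := Finset.exists_subset_card_eq h
      exact ⟨G, by omega, Or.inr (by
        simpa [hG] using Finset.card_le_card (subset_generated N G))⟩
    · exact ⟨Finset.univ, by omega, Or.inl (by
        simpa [Finset.univ_subset_iff] using subset_generated N Finset.univ)⟩
  | succ m ih =>
    obtain ⟨G, hGc, hG⟩ := ih
    by_cases huniv : generated N G = Finset.univ
    · exact ⟨G, by omega, Or.inl huniv⟩
    · have hG := hG.resolve_left huniv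
      obtain ⟨x, hx⟩ : ∃ x, x ∉ generated N G := by
        by_contra! hall
        exact huniv (Finset.eq_univ_iff_forall.2 hall)
      refine ⟨insert x G, ?_, Or.inr ?_⟩
      · have := Finset.card_insert_le x G
        omega
      · have hsub : generated N G ⊆ generated N (insert x G) :=
          generated_subset (isSubsystem_generated _ _)
            ((Finset.subset_insert x G).trans (subset_generated _ _))
        have hsq := card_le_sq_card_sdiff hN (isSubsystem_generated N G)
          (isSubsystem_generated N (insert x G)) hsub
          (subset_generated _ _ (Finset.mem_insert_self x G)) hx
        have hM : M ≤ (generated N (insert x G) \ generated N G).card := by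
          by_contra! hlt
          have := Nat.pow_lt_pow_left hlt two_ne_zero
          omega
        have := Finset.card_sdiff_add_card_eq_card hsub
        rw [Nat.mul_succ]
        omega

lemma exists_generating [Fintype V] {N : V → V → V} (hN : IsStep N) {M : ℕ} (hM : 0 < M) :
    ∃ G : Finset V, G.card ≤ M ^ 2 + Fintype.card V / M + 1 ∧
      generated N G = Finset.univ := by
  obtain ⟨G, hc, hG⟩ := exists_card_le_generated hN M (Fintype.card V / M + 1)
  refine ⟨G, by omega, hG.resolve_right fun h => ?_⟩
  have h1 := Finset.card_le_univ (generated N G)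
  have h2 := Nat.lt_mul_div_succ (Fintype.card V) hM
  omega

end Step

section Design

variable {v : ℕ}

/-- The cycle of `B` through the edge `{a, b}` continues from `b` to `c`. -/
def Continues (B : Set (Block v)) (a b c : ZMod v) : Prop :=
  c ≠ a ∧ ∃ E ∈ B, s(a, b) ∈ E ∧ s(b, c) ∈ E

lemma IsDesign.exists_cycle {B : Set (Block v)} (hB : IsDesign v 5 B) {a b : ZMod v}
    (hab : a ≠ b) : ∃ c : Fin 5 → ZMod v, Function.Injective c ∧ c 0 = a ∧ c 1 = b ∧
      edgesOf c ∈ B := by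
  obtain ⟨E, ⟨hE, hmem⟩, -⟩ := hB.2 s(a, b) (by simpa using hab)
  obtain ⟨c, hc, rfl⟩ := hB.1 E hE
  obtain ⟨i, hi⟩ := mem_edgesOf.1 hmem
  rcases Sym2.eq_iff.1 hi with ⟨h1, h2⟩ | ⟨h1, h2⟩
  · refine ⟨fun j => c (i + j), hc.comp (add_right_injective i), by simpa using h1, h2, ?_⟩
    convert hE using 1
    ext e
    rw [mem_edgesOf, mem_edgesOf]
    constructor
    · rintro ⟨j, rfl⟩
      exact ⟨i + j, by rw [add_assoc]⟩
    · rintro ⟨j, rfl⟩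
      exact ⟨j - i, by
        rw [show i + (j - i) = j by abel, show i + (j - i + 1) = j + 1 by abel]⟩
  · refine ⟨fun j => c (i + 1 - j), hc.comp (sub_right_injective), by simpa using h2,
      by simpa using h1, ?_⟩
    convert hE using 1
    ext e
    rw [mem_edgesOf, mem_edgesOf]
    constructor
    · rintro ⟨j, rfl⟩
      exact ⟨i - j, by rw [Sym2.eq_swap,
        show i + 1 - (j + 1) = i - j by abel, show i + 1 - j = i - j + 1 by abel]⟩
    · rintro ⟨j, rfl⟩
      exact ⟨i - j, by rw [Sym2.eq_swap,
        show i + 1 - (i - j + 1) = j by abel, show i + 1 - (i - j) = j + 1 by abel]⟩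

lemma IsDesign.continues_iff {B : Set (Block v)} (hB : IsDesign v 5 B) {c : Fin 5 → ZMod v}
    (hc : Function.Injective c) (hE : edgesOf c ∈ B) (i : Fin 5) (y : ZMod v) :
    (Continues B (c i) (c (i + 1)) y ↔ y = c (i + 2)) ∧
    (Continues B (c (i + 2)) (c (i + 1)) y ↔ y = c i) := by
  have huniq : ∀ i j E, i ≠ j → E ∈ B → s(c i, c j) ∈ E → s(c i, c j) ∈ edgesOf c →
      E = edgesOf c := fun i j E hij hEB h h' =>
    (hB.2 s(c i, c j) (by simpa using hc.ne hij)).unique ⟨hEB, h⟩ ⟨hE, h'⟩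
  have d1 : i ≠ i + 1 := by revert i; decide
  have d2 : i + 2 ≠ i + 1 := by revert i; decide
  have d3 : i + 2 ≠ i := by revert i; decide
  have m1 : s(c i, c (i + 1)) ∈ edgesOf c := mem_edgesOf.2 ⟨i, rfl⟩
  have m2 : s(c (i + 1), c (i + 2)) ∈ edgesOf c :=
    mem_edgesOf.2 ⟨i + 1, by rw [add_assoc]; rfl⟩
  have key : ∀ y, s(c (i + 1), y) ∈ edgesOf c → y = c i ∨ y = c (i + 2) := by
    intro y hy
    obtain ⟨j, hj⟩ := mem_edgesOf.1 hy
    rcases Sym2.eq_iff.1 hj with ⟨h1, h2⟩ | ⟨h1, h2⟩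
    · right
      rw [← h2, hc h1, add_assoc]; rfl
    · left
      rw [← h1, add_right_cancel (hc h2)]
  refine ⟨⟨?_, ?_⟩, ⟨?_, ?_⟩⟩
  · rintro ⟨hne, E, hEB, h1, h2⟩
    rw [huniq _ _ E d1 hEB h1 m1] at h2
    exact (key y h2).resolve_left hne
  · rintro rfl
    exact ⟨hc.ne d3, _, hE, m1, m2⟩
  · rintro ⟨hne, E, hEB, h1, h2⟩
    rw [huniq _ _ E d2 hEB h1 (by rwa [Sym2.eq_swap])] at h2
    exact (key y h2).resolve_right hne
  · rintro rfl
    exact ⟨hc.ne d3.symm, _, hE, by rwa [Sym2.eq_swap], by rwa [Sym2.eq_swap]⟩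

lemma IsDesign.exists_step {B : Set (Block v)} (hB : IsDesign v 5 B) :
    ∃ N : ZMod v → ZMod v → ZMod v, IsStep N ∧
      ∀ a b c, a ≠ b → (Continues B a b c ↔ c = N a b) := by
  have h : ∀ a b : ZMod v, ∃ n, a ≠ b → ∀ c, Continues B a b c ↔ c = n := by
    intro a b
    by_cases hab : a = b
    · exact ⟨a, fun h => absurd hab h⟩
    · obtain ⟨c, hc, rfl, rfl, hE⟩ := hB.exists_cycle hab
      exact ⟨c 2, fun _ y => (hB.continues_iff hc hE 0 y).1⟩
  choose N hN using h
  refine ⟨N, ?_, fun a b c hab => hN a b hab c⟩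
  intro x w hxw
  obtain ⟨c, hc, rfl, rfl, hE⟩ := hB.exists_cycle hxw
  refine ⟨c, hc, rfl, rfl, fun i => ?_⟩
  have d1 : i ≠ i + 1 := by revert i; decide
  have d2 : i + 2 ≠ i + 1 := by revert i; decide
  exact ⟨((hB.continues_iff hc hE i _).1.1 ((hN _ _ (hc.ne d1) _).2 rfl)),
    ((hB.continues_iff hc hE i _).2.1 ((hN _ _ (hc.ne d2) _).2 rfl))⟩

lemma continues_image_iff (B : Set (Block v)) (f : ZMod v ≃ ZMod v) (a b c : ZMod v) :
    Continues ((fun E : Block v => E.image (Sym2.map f)) '' B) (f a) (f b) (f c) ↔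
      Continues B a b c := by
  have hf := Sym2.map.injective f.injective
  have hmem : ∀ (E : Block v) (a b : ZMod v),
      s(f a, f b) ∈ E.image (Sym2.map f) ↔ s(a, b) ∈ E := fun E a b => by
    rw [← Sym2.map_mk, hf.mem_finset_image]
  simp only [Continues, Set.exists_mem_image, hmem, f.injective.ne_iff]

lemma IsCyclicDesign.continues_add_one {B : Set (Block v)} (hB : IsCyclicDesign v 5 B)
    {a b c : ZMod v} (h : Continues B a b c) : Continues B (a + 1) (b + 1) (c + 1) := by
  obtain ⟨hne, E, hE, h1, h2⟩ := h
  refine ⟨by simpa using hne, _, hB.2 E hE 1, ?_, ?_⟩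
  · exact Finset.mem_image.2 ⟨_, h1, rfl⟩
  · exact Finset.mem_image.2 ⟨_, h2, rfl⟩

lemma isomorphic_equivalence :
    Equivalence fun B B' : {B : Set (Block v) // IsCyclicDesign v 5 B} =>
      Isomorphic B.1 B'.1 where
  refl B := ⟨Equiv.refl _, by simp⟩
  symm := by
    rintro B B' ⟨f, hf⟩
    refine ⟨f.symm, ?_⟩
    rw [hf, Set.image_image]
    simp [Finset.image_image, ← Sym2.map_comp]
  trans := by
    rintro B B' B'' ⟨f, hf⟩ ⟨g, hg⟩
    refine ⟨f.trans g, ?_⟩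
    rw [hg, hf, Set.image_image]
    simp [Finset.image_image, ← Sym2.map_comp]

lemma eq_of_conj_eq [NeZero v] {f f' : ZMod v ≃ ZMod v} (h0 : f.symm 0 = f'.symm 0)
    (h : ∀ x, f.symm (f x + 1) = f'.symm (f' x + 1)) : f = f' := by
  have key : ∀ k : ℕ, f.symm k = f'.symm k := by
    intro k
    induction k with
    | zero => simpa using h0
    | succ k ih =>
      have := h (f.symm k)
      rw [f.apply_symm_apply, ih, f'.apply_symm_apply] at this
      simpa using this
  have : f.symm = f'.symm := by
    ext1 x
    have := key x.val
    rwa [ZMod.natCast_zmod_val] at this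
  rw [← f.symm_symm, this, f'.symm_symm]

theorem card_isomorphic_le [NeZero v] (B : {B : Set (Block v) // IsCyclicDesign v 5 B})
    {M : ℕ} (hM : 0 < M) :
    Nat.card {B' : {B : Set (Block v) // IsCyclicDesign v 5 B} // Isomorphic B.1 B'.1} ≤
      v ^ (M ^ 2 + v / M + 2) := by
  classical
  obtain ⟨N, hN, hstep⟩ := B.2.1.exists_step
  obtain ⟨G, hGc, hG⟩ := exists_generating hN hM
  choose f hf using fun B' : {B' : {B : Set (Block v) // IsCyclicDesign v 5 B} //
    Isomorphic B.1 B'.1} => B'.2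
  have hσ : ∀ B' a b, a ≠ b → (f B').symm (f B' (N a b) + 1) =
      N ((f B').symm (f B' a + 1)) ((f B').symm (f B' b + 1)) := by
    intro B' a b hab
    rw [← hstep _ _ _ (by simpa using hab), ← continues_image_iff _ (f B'), ← hf B']
    simp only [Equiv.apply_symm_apply]
    refine B'.1.2.continues_add_one ?_
    rw [hf B', continues_image_iff, hstep _ _ _ hab]
  let φ : {B' : {B : Set (Block v) // IsCyclicDesign v 5 B} // Isomorphic B.1 B'.1} →
      ZMod v × (G → ZMod v) :=
    fun B' => ((f B').symm 0, fun x => (f B').symm (f B' x + 1))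
  have hφ : Function.Injective φ := by
    intro B₁ B₂ h
    have h0 : (f B₁).symm 0 = (f B₂).symm 0 := congrArg Prod.fst h
    have h1 : ∀ x : G, (f B₁).symm (f B₁ x + 1) = (f B₂).symm (f B₂ x + 1) :=
      congrFun (congrArg Prod.snd h)
    have hW : IsSubsystem N
        (Finset.univ.filter fun x => (f B₁).symm (f B₁ x + 1) = (f B₂).symm (f B₂ x + 1)) := by
      intro a ha b hb hab
      simp only [Finset.mem_filter, Finset.mem_univ, true_and] at ha hb ⊢
      rw [hσ _ _ _ hab, hσ _ _ _ hab, ha, hb]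
    have hall := generated_subset hW (G := G) (fun x hx => by simpa using h1 ⟨x, hx⟩)
    rw [hG] at hall
    have heq : f B₁ = f B₂ := eq_of_conj_eq h0 fun x => by
      simpa using hall (Finset.mem_univ x)
    apply Subtype.ext
    apply Subtype.ext
    rw [hf B₁, hf B₂, heq]
  calc _ ≤ Nat.card (ZMod v × (G → ZMod v)) := Nat.card_le_card_of_injective φ hφ
    _ = v ^ (G.card + 1) := by
      simp [Nat.card_eq_fintype_card, ZMod.card, pow_succ, mul_comm]
    _ ≤ _ := Nat.pow_le_pow_right (Nat.pos_of_ne_zero (NeZero.ne v)) (by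
      rw [ZMod.card] at hGc; omega)

theorem card_le_mul_NC [NeZero v] {M : ℕ} (hM : 0 < M) :
    Nat.card {B : Set (Block v) // IsCyclicDesign v 5 B} ≤
      v ^ (M ^ 2 + v / M + 2) * NC v 5 := by
  classical
  let mk := Quot.mk fun B B' : {B : Set (Block v) // IsCyclicDesign v 5 B} =>
    Isomorphic B.1 B'.1
  have := Fintype.ofFinite {B : Set (Block v) // IsCyclicDesign v 5 B}
  have := Fintype.ofFinite (Quot fun B B' : {B : Set (Block v) // IsCyclicDesign v 5 B} =>
    Isomorphic B.1 B'.1)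
  have h := Finset.card_le_mul_card_image (f := mk) Finset.univ (v ^ (M ^ 2 + v / M + 2)) (by
    intro q hq
    obtain ⟨B, -, rfl⟩ := Finset.mem_image.1 hq
    refine le_trans ?_ (card_isomorphic_le B hM)
    rw [← Fintype.card_subtype, ← Nat.card_eq_fintype_card]
    refine Nat.card_le_card_of_injective (fun B' => ⟨B'.1, ?_⟩) ?_
    · exact (isomorphic_equivalence.eqvGen_iff).1 (Quot.eqvGen_exact B'.2.symm)
    · intro B₁ B₂ h
      exact Subtype.ext (congrArg (fun x => x.1) h))
  rw [Finset.image_univ_of_surjective Quot.mk_surjective] at h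
  simpa [NC, Nat.card_eq_fintype_card] using h

end Design

lemma pow_mul_pow_le_factorial {n K : ℕ} (hn : 10 ^ 18 ≤ n) (hK : n ≤ K + 2) :
    30 ^ n * (10 * n + 1) ^ (100 ^ 2 + (10 * n + 1) / 100 + 2) ≤ K.factorial := by
  obtain ⟨q, hq⟩ : ∃ q, q = n / 8 := ⟨_, rfl⟩
  have hbase : 30 ^ 9 * 99 ≤ q := by norm_num; omega
  calc 30 ^ n * (10 * n + 1) ^ (100 ^ 2 + (10 * n + 1) / 100 + 2)
      ≤ 30 ^ (9 * q) * (99 * q) ^ q := by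
        refine Nat.mul_le_mul (Nat.pow_le_pow_right (by norm_num) (by omega)) ?_
        exact (Nat.pow_le_pow_right (by omega) (by omega)).trans
          (Nat.pow_le_pow_left (by omega) q)
    _ = (30 ^ 9 * 99) ^ q * q ^ q := by rw [pow_mul, mul_pow, mul_pow, mul_assoc]
    _ ≤ q ^ q * q ^ q := Nat.mul_le_mul_right _ (Nat.pow_le_pow_left hbase q)
    _ = q ^ (q + q) := (pow_add q q q).symm
    _ ≤ (q + 1) ^ (q + q) := Nat.pow_le_pow_left (by omega) _
    _ ≤ q.factorial * (q + 1) ^ (q + q) := Nat.le_mul_of_pos_left _ (Nat.factorial_pos q)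
    _ ≤ (q + (q + q)).factorial := Nat.factorial_mul_pow_le_factorial
    _ ≤ K.factorial := Nat.factorial_le (by omega)

theorem pow_le_NC {n : ℕ} (hn : 10 ^ 18 ≤ n) : 30 ^ n ≤ NC (10 * n + 1) 5 := by
  obtain ⟨K, hK, F, hF⟩ := exists_injective_perm_of_large (n := n) (by omega)
  have h1 := Nat.card_le_card_of_injective F hF
  rw [Nat.card_perm, Nat.card_fin] at h1
  have h2 := ((pow_mul_pow_le_factorial hn hK).trans h1).trans
    (card_le_mul_NC (v := 10 * n + 1) (M := 100) (by norm_num))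
  rw [mul_comm] at h2
  exact Nat.le_of_mul_le_mul_left h2 (by positivity)

end CCS

/-- For all sufficiently large `n` not congruent to `4 (mod 7)`,
`NC(10n+1, 5) ≥ 29.7^n`. -/
theorem stmt9 : ∃ N : ℕ, ∀ n : ℕ, N ≤ n → n % 7 ≠ 4 →
    (29.7 : ℝ) ^ n ≤ (CCS.NC (10 * n + 1) 5 : ℝ) := by
  refine ⟨10 ^ 18, fun n hn _ => ?_⟩
  calc (29.7 : ℝ) ^ n ≤ 30 ^ n := pow_le_pow_left₀ (by norm_num) (by norm_num) n
    _ ≤ (CCS.NC (10 * n + 1) 5 : ℝ) := by exact_mod_cast CCS.pow_le_NC hn
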